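/- arXiv:2210.03111 — 2 statements merged into one kernel-verified Lean document; each statement's English description precedes it below -/
import Mathlib

section
/- Let F = F(x^1,…,x^N) satisfy the commutativity equations F_i F_j = F_j F_i for all i,j, suppose the matrix P = (F_{i₀ i j}) (rows i ≠ i₀) has rank N−1, and suppose in addition that there exist functions η^1,…,η^N such that the linear combination G = Σ_k η^k F_k is a non-degenerate matrix. Then the matrix B with B_{ij} = Σ_k A^k F_{kij}, A^k = (−1)^{k+1} det P_k, is a non-zero multiple of the identity matrix: B = h·Id with h ≠ 0. -/
open scoped BigOperators

noncomputable def pd {N : ℕ} (i : Fin N) (f : (Fin N → ℂ) → ℂ) : (Fin N → ℂ) → ℂ :=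
  fun x => fderiv ℂ f x (Pi.single i 1)

noncomputable def D3 {N : ℕ} (F : (Fin N → ℂ) → ℂ) (i p q : Fin N) (x : Fin N → ℂ) : ℂ :=
  pd i (pd p (pd q F)) x

noncomputable def Fmat {N : ℕ} (F : (Fin N → ℂ) → ℂ) (i : Fin N) (x : Fin N → ℂ) :
    Matrix (Fin N) (Fin N) ℂ :=
  Matrix.of fun p q => D3 F i p q x

/-- The `(N−1)×N` matrix `P = (F_{i₀ i j})` with rows indexed by `i ≠ i₀`
(in increasing order) and columns by `j = 1,…,N`. -/
noncomputable def Pmat {n : ℕ} (F : (Fin (n + 1) → ℂ) → ℂ) (i₀ : Fin (n + 1))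
    (x : Fin (n + 1) → ℂ) : Matrix (Fin n) (Fin (n + 1)) ℂ :=
  Matrix.of fun i j => D3 F i₀ (i₀.succAbove i) j x

/-- `A^k = (−1)^{k+1} det P_k` (with the 1-based sign convention of the paper,
so `(−1)^{k}` for the 0-based index `k`), where `P_k` is `P` with the `k`-th
column removed. -/
noncomputable def Acoef {n : ℕ} (F : (Fin (n + 1) → ℂ) → ℂ) (i₀ : Fin (n + 1))
    (x : Fin (n + 1) → ℂ) (k : Fin (n + 1)) : ℂ :=
  (-1 : ℂ) ^ (k : ℕ) *
    (Matrix.of fun i j : Fin n => Pmat F i₀ x i (k.succAbove j)).det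

/-- The matrix `B` with entries `B_{ij} = Σ_k A^k F_{kij}`. -/
noncomputable def Bmat {n : ℕ} (F : (Fin (n + 1) → ℂ) → ℂ) (i₀ : Fin (n + 1))
    (x : Fin (n + 1) → ℂ) : Matrix (Fin (n + 1)) (Fin (n + 1)) ℂ :=
  Matrix.of fun i j => ∑ k, Acoef F i₀ x k * D3 F k i j x

lemma ContDiff.pd {N : ℕ} {m k : WithTop ℕ∞} {f : (Fin N → ℂ) → ℂ} (hf : ContDiff ℂ k f)
    (hmk : m + 1 ≤ k) (i : Fin N) : ContDiff ℂ m (pd i f) :=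
  (hf.fderiv_right hmk).clm_apply contDiff_const

lemma pd_comm {N : ℕ} {f : (Fin N → ℂ) → ℂ} (hf : ContDiff ℂ 2 f) (i j : Fin N) :
    pd i (pd j f) = pd j (pd i f) := by
  funext x
  have hd : DifferentiableAt ℂ (fderiv ℂ f) x :=
    ((hf.fderiv_right (m := 1) (by norm_num)).differentiable (by norm_num)).differentiableAt
  have key : ∀ a b : Fin N, pd a (pd b f) x
      = fderiv ℂ (fderiv ℂ f) x (Pi.single a 1) (Pi.single b 1) := by
    intro a b
    unfold pd
    rw [fderiv_clm_apply hd (differentiableAt_const _)]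
    simp
  rw [key, key]
  exact (hf.contDiffAt.isSymmSndFDerivAt (by simp)) _ _

lemma D3_swap_left {N : ℕ} {F : (Fin N → ℂ) → ℂ} (hF : ContDiff ℂ 3 F) (i j k : Fin N)
    (x : Fin N → ℂ) : D3 F i j k x = D3 F j i k x := by
  unfold D3
  rw [pd_comm (hF.pd (m := 2) (by norm_num) k)]

lemma D3_swap_right {N : ℕ} {F : (Fin N → ℂ) → ℂ} (hF : ContDiff ℂ 3 F) (i j k : Fin N)
    (x : Fin N → ℂ) : D3 F i j k x = D3 F i k j x := by
  unfold D3
  rw [pd_comm (hF.of_le (by norm_num))]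

lemma D3_swap_outer {N : ℕ} {F : (Fin N → ℂ) → ℂ} (hF : ContDiff ℂ 3 F) (i j k : Fin N)
    (x : Fin N → ℂ) : D3 F i j k x = D3 F k j i x := by
  rw [D3_swap_left hF, D3_swap_right hF, D3_swap_left hF]

/-- The signed maximal minors of an `n × (n + 1)` matrix of rank `n` are proportional, with a
non-zero factor, to any non-zero vector of its kernel. -/
lemma Matrix.exists_signed_minors_eq_smul {K : Type*} [Field K] {n : ℕ}
    (P : Matrix (Fin n) (Fin (n + 1)) K) (hrank : P.rank = n) {e : Fin (n + 1) → K} (he : e ≠ 0)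
    (hPe : P.mulVec e = 0) :
    ∃ t : K, t ≠ 0 ∧ ∀ k : Fin (n + 1),
      (-1) ^ (k : ℕ) * (P.submatrix id k.succAbove).det = t * e k := by
  set A : Fin (n + 1) → K := fun k => (-1) ^ (k : ℕ) * (P.submatrix id k.succAbove).det
  have hdet : ∀ r : Fin (n + 1) → K,
      (Matrix.of (Fin.cons r P : Fin (n + 1) → Fin (n + 1) → K)).det = ∑ k, r k * A k := by
    intro r
    rw [Matrix.det_succ_row_zero]
    refine Finset.sum_congr rfl fun k _ => ?_
    have : (Matrix.of (Fin.cons r P : Fin (n + 1) → Fin (n + 1) → K)).submatrix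
        Fin.succ k.succAbove = P.submatrix id k.succAbove := rfl
    rw [this]
    change (-1) ^ (k : ℕ) * r k * _ = r k * ((-1) ^ (k : ℕ) * _)
    ring
  have hPA : P.mulVec A = 0 := by
    funext i
    have h := hdet (P i)
    rw [Matrix.det_zero_of_row_eq (Fin.succ_ne_zero i).symm rfl] at h
    exact h.symm
  have hker : Module.finrank K (LinearMap.ker P.mulVecLin) = 1 := by
    have h := P.mulVecLin.finrank_range_add_finrank_ker
    have h' : Module.finrank K (LinearMap.range P.mulVecLin) = n := hrank
    rw [h', Module.finrank_fin_fun] at h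
    omega
  have hspan : ∀ v, P.mulVec v = 0 → ∃ t : K, t • e = v := by
    intro v hv
    obtain ⟨t, ht⟩ := exists_smul_eq_of_finrank_eq_one hker
      (x := ⟨e, by simpa using hPe⟩) (by simpa [Subtype.ext_iff] using he) ⟨v, by simpa using hv⟩
    exact ⟨t, congrArg Subtype.val ht⟩
  obtain ⟨t, ht⟩ := hspan A hPA
  refine ⟨t, ?_, fun k => (congrFun ht k).symm⟩
  rintro rfl
  have hA0 : A = 0 := by rw [← ht, zero_smul]
  obtain ⟨k, hk⟩ := Function.ne_iff.mp he
  have h0 : (Matrix.of (Fin.cons (Pi.single k 1) P : Fin (n + 1) → Fin (n + 1) → K)).det = 0 := by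
    rw [hdet, hA0]
    simp
  obtain ⟨v, hv, hQv⟩ := Matrix.exists_mulVec_eq_zero_iff.mpr h0
  have hvk : v k = 0 := by
    have h : Pi.single k 1 ⬝ᵥ v = 0 := congrFun hQv 0
    simpa using h
  obtain ⟨s, rfl⟩ := hspan v (funext fun i => congrFun hQv i.succ)
  have hs : s = 0 := by simpa [show e k ≠ 0 from hk] using hvk
  exact hv (by rw [hs, zero_smul])

/-- A commuting family of matrices `M i`, symmetric under exchanging the family index with the
column index, has a unit vector as soon as some linear combination is invertible. -/
lemma Matrix.exists_mulVec_eq_single_of_commute {K ι : Type*} [Field K] [Fintype ι]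
    [DecidableEq ι] (M : ι → Matrix ι ι K) (hcomm : ∀ i j, M i * M j = M j * M i)
    (hsymm : ∀ i p q, M i p q = M q p i) (η : ι → K) (hG : IsUnit (∑ k, η k • M k).det) :
    ∃ e : ι → K, ∀ j, (M j).mulVec e = Pi.single j 1 := by
  set G := ∑ k, η k • M k with hGdef
  have hGM : ∀ j, G * M j = M j * G := by
    intro j
    simp [hGdef, Finset.sum_mul, Finset.mul_sum, hcomm j]
  refine ⟨G⁻¹.mulVec η, fun j => ?_⟩
  apply Matrix.mulVec_injective_of_isUnit ((Matrix.isUnit_iff_isUnit_det G).mpr hG)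
  rw [Matrix.mulVec_mulVec, hGM, Matrix.mulVec_mulVec, Matrix.mul_assoc,
    Matrix.mul_nonsing_inv _ hG, Matrix.mul_one, Matrix.mulVec_single_one]
  funext p
  simp [hGdef, Matrix.mulVec, dotProduct, Matrix.sum_apply, hsymm j p, mul_comm]

/-- if moreover some linear combination `G = Σ η^k F_k` is
non-degenerate, then `B` is a non-zero multiple of the identity. -/
theorem stmt14 {n : ℕ} (F : (Fin (n + 1) → ℂ) → ℂ) (hF : ContDiff ℂ ⊤ F)
    (hcomm : ∀ x, ∀ i j : Fin (n + 1), Fmat F i x * Fmat F j x = Fmat F j x * Fmat F i x)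
    (i₀ : Fin (n + 1)) (x : Fin (n + 1) → ℂ)
    (hrank : (Pmat F i₀ x).rank = n)
    (η : Fin (n + 1) → ℂ)
    (hG : IsUnit (∑ k, η k • Fmat F k x).det) :
    ∃ h : ℂ, h ≠ 0 ∧ Bmat F i₀ x = h • (1 : Matrix (Fin (n + 1)) (Fin (n + 1)) ℂ) := by
  have hF3 : ContDiff ℂ 3 F := hF.of_le le_top
  obtain ⟨e, he⟩ := Matrix.exists_mulVec_eq_single_of_commute (fun i => Fmat F i x) (hcomm x)
    (fun i p q => D3_swap_outer hF3 i p q x) η hG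
  have he0 : e ≠ 0 := by
    rintro rfl
    simpa using congrFun (he i₀) i₀
  have hPe : (Pmat F i₀ x).mulVec e = 0 := by
    funext i
    have h := congrFun (he i₀) (i₀.succAbove i)
    rw [Pi.single_eq_of_ne (Fin.succAbove_ne i₀ i)] at h
    exact h
  obtain ⟨t, ht, hA⟩ := (Pmat F i₀ x).exists_signed_minors_eq_smul hrank he0 hPe
  refine ⟨t, ht, ?_⟩
  ext i j
  have h : ∑ k, D3 F j i k x * e k = (Pi.single j 1 : Fin (n + 1) → ℂ) i := congrFun (he j) i
  have hAe : ∀ k, Acoef F i₀ x k = t * e k := hA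
  simp only [Bmat, Matrix.of_apply, hAe, Matrix.smul_apply, Matrix.one_apply, smul_eq_mul]
  rw [← Pi.single_apply, ← h, Finset.mul_sum]
  refine Finset.sum_congr rfl fun k _ => ?_
  rw [D3_swap_outer hF3 k i j]
  ring
end

section
/- Let F(x) = Σ_{α∈F₄⁺} c_α f((α,x)) for x = (x^1,…,x^4) ∈ ℂ⁴, where f'''(z) = cot z, F₄⁺ = {e_i (1≤i≤4), e_i ± e_j (1≤i<j≤4), ½(e_1±e_2±e_3±e_4)}, the short roots e_i and ½(e_1±e_2±e_3±e_4) have multiplicity r and the long roots e_i ± e_j have multiplicity q ≠ 0. Then the matrix h^{-1} Σ_{k=1}^4 B^k F_k equals the 4×4 identity matrix in each of the following two cases: (i) r = −2q, B^k = sin x^k ( cos x^k (−1 + Σ_{i≠k} cos 2x^i) − 2 ∏_{i≠k} cos x^i ), and h(x) = 6q + ½ Σ_{α∈F₄⁺} c_α cos(2(α,x)); (ii) r = −4q, B^k = sin x^k ( cos x^k + 2 ∏_{i≠k} cos x^i ), and h(x) = −q ( 6 + Σ_{i=1}^4 cos 2x^i + 8 ∏_{i=1}^4 cos x^i ). -/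
open scoped BigOperators

/-- The standard bilinear form on `ℂ⁴` (and `ℂ^N`). -/
noncomputable def dotc {N : ℕ} (u v : Fin N → ℂ) : ℂ := ∑ k, u k * v k

/-- Complex cotangent. -/
noncomputable def ccot (z : ℂ) : ℂ := Complex.cos z / Complex.sin z

/-- The positive half `F₄⁺` of the root system `F₄`:
`e_i (1 ≤ i ≤ 4)`, `e_i ± e_j (1 ≤ i < j ≤ 4)`, `½(e₁ ± e₂ ± e₃ ± e₄)`. -/
noncomputable def F4pos : Finset (Fin 4 → ℂ) := by
  classical
  exact
    (Finset.univ.image fun i : Fin 4 => (Pi.single i 1 : Fin 4 → ℂ)) ∪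
    ((Finset.univ.filter fun p : Fin 4 × Fin 4 × Bool => p.1 < p.2.1).image
      fun p => (Pi.single p.1 1 : Fin 4 → ℂ) +
        (if p.2.2 then (1 : ℂ) else -1) • (Pi.single p.2.1 1 : Fin 4 → ℂ)) ∪
    (Finset.univ.image fun ε : Fin 4 → Bool =>
      fun k : Fin 4 => if k = 0 then (1 / 2 : ℂ)
        else if ε k then (1 / 2 : ℂ) else (-(1 / 2) : ℂ))

/-- The `F₄` multiplicity function: `q` on long roots (square length 2) and
`r` on short roots. -/
noncomputable def F4mult (q r : ℂ) (α : Fin 4 → ℂ) : ℂ := by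
  classical exact if dotc α α = 2 then q else r

/-- The matrix entry `(F_k)_{pq} = Σ_{α∈F₄⁺} c_α α_k α_p α_q cot((α,x))`. -/
noncomputable def F4mat (q r : ℂ) (x : Fin 4 → ℂ) (k p s : Fin 4) : ℂ :=
  ∑ α ∈ F4pos, F4mult q r α * α k * α p * α s * ccot (dotc α x)

/-- The doubled positive roots of `F₄`, as integer vectors. -/
def doubledRoots : Finset (Fin 4 → ℤ) :=
  (Finset.univ.image fun i : Fin 4 => (Pi.single i 2 : Fin 4 → ℤ)) ∪
  ((Finset.univ.filter fun p : Fin 4 × Fin 4 × Bool => p.1 < p.2.1).image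
    fun p => (Pi.single p.1 2 : Fin 4 → ℤ) +
      (if p.2.2 then (1 : ℤ) else -1) • (Pi.single p.2.1 2 : Fin 4 → ℤ)) ∪
  (Finset.univ.image fun ε : Fin 4 → Bool =>
    fun k : Fin 4 => if k = 0 then (1 : ℤ) else if ε k then 1 else -1)

/-- Half of an integer vector, as a complex vector. -/
noncomputable def halve (v : Fin 4 → ℤ) : Fin 4 → ℂ := fun k => (v k : ℂ) / 2

theorem halve_injective : Function.Injective halve := by
  intro v w h
  funext k
  have hk := congrFun h k
  simp only [halve] at hk
  exact_mod_cast (div_left_inj' (two_ne_zero' ℂ)).1 hk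

theorem halve_single (i : Fin 4) : halve (Pi.single i 2) = Pi.single i 1 := by
  funext k
  by_cases h : k = i
  · subst h; simp [halve]
  · simp [halve, h]

theorem F4pos_eq_image : F4pos = doubledRoots.image halve := by
  classical
  have hadd (v w : Fin 4 → ℤ) (n : ℤ) : halve (v + n • w) = halve v + (n : ℂ) • halve w := by
    funext k
    simp [halve]
    ring
  simp only [F4pos, doubledRoots, Finset.image_union, Finset.image_image]
  congr 1
  · congr 1
    · congr 1
      funext i
      exact (halve_single i).symm
    · apply Finset.image_congr
      intro p _
      simp only [Function.comp, hadd, halve_single]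
      congr 2
      split_ifs <;> simp
  · congr 1
    funext ε k
    simp only [Function.comp, halve]
    split_ifs <;> norm_num

theorem doubledRoots_eq : doubledRoots =
    {![2, 0, 0, 0], ![0, 2, 0, 0], ![0, 0, 2, 0], ![0, 0, 0, 2],
     ![2, 2, 0, 0], ![2, -2, 0, 0], ![2, 0, 2, 0], ![2, 0, -2, 0],
     ![2, 0, 0, 2], ![2, 0, 0, -2], ![0, 2, 2, 0], ![0, 2, -2, 0],
     ![0, 2, 0, 2], ![0, 2, 0, -2], ![0, 0, 2, 2], ![0, 0, 2, -2],
     ![1, 1, 1, 1], ![1, 1, 1, -1], ![1, 1, -1, 1], ![1, 1, -1, -1],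
     ![1, -1, 1, 1], ![1, -1, 1, -1], ![1, -1, -1, 1], ![1, -1, -1, -1]} := by
  decide

theorem sum_F4pos (f : (Fin 4 → ℂ) → ℂ) : ∑ α ∈ F4pos, f α =
    f ![1, 0, 0, 0] + f ![0, 1, 0, 0] + f ![0, 0, 1, 0] + f ![0, 0, 0, 1] +
    f ![1, 1, 0, 0] + f ![1, -1, 0, 0] + f ![1, 0, 1, 0] + f ![1, 0, -1, 0] +
    f ![1, 0, 0, 1] + f ![1, 0, 0, -1] + f ![0, 1, 1, 0] + f ![0, 1, -1, 0] +
    f ![0, 1, 0, 1] + f ![0, 1, 0, -1] + f ![0, 0, 1, 1] + f ![0, 0, 1, -1] +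
    f ![1/2, 1/2, 1/2, 1/2] + f ![1/2, 1/2, 1/2, -1/2] +
    f ![1/2, 1/2, -1/2, 1/2] + f ![1/2, 1/2, -1/2, -1/2] +
    f ![1/2, -1/2, 1/2, 1/2] + f ![1/2, -1/2, 1/2, -1/2] +
    f ![1/2, -1/2, -1/2, 1/2] + f ![1/2, -1/2, -1/2, -1/2] := by
  classical
  have hv (a b c d : ℤ) : halve ![a, b, c, d] = ![(a : ℂ) / 2, b / 2, c / 2, d / 2] := by
    funext k
    fin_cases k <;> rfl
  rw [F4pos_eq_image, Finset.sum_image halve_injective.injOn, doubledRoots_eq]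
  repeat rw [Finset.sum_insert (by decide)]
  rw [Finset.sum_singleton]
  simp only [hv]
  norm_num
  ring

section Trigonometry

open Complex

theorem sin_mul_ccot {z : ℂ} (hz : sin z ≠ 0) : sin z * ccot z = cos z :=
  mul_div_cancel₀ _ hz

theorem sin_two_mul_mul_ccot {z : ℂ} (hz : sin z ≠ 0) :
    sin (2 * z) * ccot z = 1 + cos (2 * z) := by
  rw [sin_two_mul, cos_two_mul]
  linear_combination 2 * cos z * sin_mul_ccot hz

theorem sin_add_sin_mul_ccot {z : ℂ} (hz : sin z ≠ 0) (u : ℂ) :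
    (sin u + sin (2 * z - u)) * ccot z = cos u + cos (2 * z - u) := by
  have hs : sin u + sin (2 * z - u) = 2 * sin z * cos (z - u) := by
    rw [two_mul, add_sub_assoc, sin_add, ← sub_sub_cancel z u, sin_sub z (z - u)]
    simp only [sub_sub_cancel]
    ring
  have hc : cos u + cos (2 * z - u) = 2 * cos z * cos (z - u) := by
    rw [two_mul, add_sub_assoc, cos_add, ← sub_sub_cancel z u, cos_sub z (z - u)]
    simp only [sub_sub_cancel]
    ring
  rw [hs, hc]
  linear_combination 2 * cos (z - u) * sin_mul_ccot hz

/-- The first component of the vector field `B` in the case `r = -2q`; the other components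
are obtained by permuting the coordinates. -/
noncomputable def fieldTwo (a b c d : ℂ) : ℂ :=
  sin a * (cos a * (-1 + cos (2 * b) + cos (2 * c) + cos (2 * d)) - 2 * (cos b * cos c * cos d))

/-- The first component of the vector field `B` in the case `r = -4q`; the other components
are obtained by permuting the coordinates. -/
noncomputable def fieldFour (a b c d : ℂ) : ℂ :=
  sin a * (cos a + 2 * (cos b * cos c * cos d))

theorem fieldTwo_add_mul_ccot (a b c d : ℂ) (h : sin (a + b) ≠ 0) :
    (fieldTwo a b c d + fieldTwo b a c d) * ccot (a + b) =
      cos (a + b) * (cos (a + b) + cos (a - b) * (cos (2 * c) + cos (2 * d) - 1)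
        - 2 * cos c * cos d) := by
  have key : fieldTwo a b c d + fieldTwo b a c d = sin (a + b) *
      (cos (a + b) + cos (a - b) * (cos (2 * c) + cos (2 * d) - 1) - 2 * cos c * cos d) := by
    simp only [fieldTwo, cos_two_mul, sin_add, cos_add, cos_sub]
    ring_nf
    simp only [sin_sq]
    ring
  rw [key]
  linear_combination (cos (a + b) + cos (a - b) * (cos (2 * c) + cos (2 * d) - 1)
    - 2 * cos c * cos d) * sin_mul_ccot h

theorem fieldFour_add_mul_ccot (a b c d : ℂ) (h : sin (a + b) ≠ 0) :
    (fieldFour a b c d + fieldFour b a c d) * ccot (a + b) =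
      cos (a + b) * (cos (a - b) + 2 * cos c * cos d) := by
  have key : fieldFour a b c d + fieldFour b a c d = sin (a + b) *
      (cos (a - b) + 2 * cos c * cos d) := by
    simp only [fieldFour, sin_add, cos_sub]
    ring_nf
    simp only [sin_sq]
    ring
  rw [key]
  linear_combination (cos (a - b) + 2 * cos c * cos d) * sin_mul_ccot h

/-- The part of `cos (a + b + c + d)` of degree two in the sines, up to sign. -/
noncomputable def sinPairs (a b c d : ℂ) : ℂ :=
  sin a * sin b * cos c * cos d + sin a * sin c * cos b * cos d + sin a * sin d * cos b * cos c +
    sin b * sin c * cos a * cos d + sin b * sin d * cos a * cos c + sin c * sin d * cos a * cos b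

theorem cos_add_add_add (a b c d : ℂ) : cos (a + b + c + d) =
    cos a * cos b * cos c * cos d - sinPairs a b c d + sin a * sin b * sin c * sin d := by
  simp only [sinPairs, sin_add, cos_add]
  ring

theorem sum_cos_add_cos (a b c d y : ℂ) (hy : 2 * y = a + b + c + d) :
    (cos (2 * a) + cos (2 * y - 2 * a) + (cos (2 * b) + cos (2 * y - 2 * b)) +
        (cos (2 * c) + cos (2 * y - 2 * c)) + (cos (2 * d) + cos (2 * y - 2 * d))) / 2 =
      cos a ^ 2 + cos b ^ 2 + cos c ^ 2 + cos d ^ 2 - 2 + 2 * (cos a * cos b * cos c * cos d) -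
        2 * (sin a * sin b * sin c * sin d) := by
  have ha : 2 * y - 2 * a = b + c + d - a := by linear_combination hy
  have hb : 2 * y - 2 * b = a + c + d - b := by linear_combination hy
  have hc : 2 * y - 2 * c = a + b + d - c := by linear_combination hy
  have hd : 2 * y - 2 * d = a + b + c - d := by linear_combination hy
  simp only [ha, hb, hc, hd, cos_two_mul, sin_add, cos_add, cos_sub]
  ring

theorem fieldFour_sum_mul_ccot (a b c d y : ℂ) (hy : 2 * y = a + b + c + d) (h : sin y ≠ 0) :
    (fieldFour a b c d + fieldFour b a c d + fieldFour c a b d + fieldFour d a b c) * ccot y =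
      cos a ^ 2 + cos b ^ 2 + cos c ^ 2 + cos d ^ 2 - 1 + 3 * (cos a * cos b * cos c * cos d) -
        sinPairs a b c d - sin a * sin b * sin c * sin d := by
  have key : fieldFour a b c d + fieldFour b a c d + fieldFour c a b d + fieldFour d a b c =
      sin (2 * y) + (sin (2 * a) + sin (2 * y - 2 * a) + (sin (2 * b) + sin (2 * y - 2 * b)) +
        (sin (2 * c) + sin (2 * y - 2 * c)) + (sin (2 * d) + sin (2 * y - 2 * d))) / 2 := by
    simp only [fieldFour, hy, sin_two_mul, cos_two_mul, sin_add, cos_add, sin_sub]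
    ring_nf
    simp only [sin_sq]
    ring
  rw [key]
  have hsum := sum_cos_add_cos a b c d y hy
  have hcos := cos_add_add_add a b c d
  rw [← hy] at hcos
  linear_combination sin_two_mul_mul_ccot h + (sin_add_sin_mul_ccot h (2 * a) +
    sin_add_sin_mul_ccot h (2 * b) + sin_add_sin_mul_ccot h (2 * c) +
    sin_add_sin_mul_ccot h (2 * d)) / 2 + hcos + hsum

theorem fieldTwo_sum_mul_ccot (a b c d y : ℂ) (hy : 2 * y = a + b + c + d) (h : sin y ≠ 0) :
    (fieldTwo a b c d + fieldTwo b a c d + fieldTwo c a b d + fieldTwo d a b c) * ccot y =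
      (1 + cos a * cos b * cos c * cos d - sinPairs a b c d + sin a * sin b * sin c * sin d) *
        (3 * (cos a * cos b * cos c * cos d) + sinPairs a b c d +
          3 * (sin a * sin b * sin c * sin d) - 1) -
        (cos a ^ 2 + cos b ^ 2 + cos c ^ 2 + cos d ^ 2 - 2 + 2 * (cos a * cos b * cos c * cos d) -
          2 * (sin a * sin b * sin c * sin d)) := by
  have key : fieldTwo a b c d + fieldTwo b a c d + fieldTwo c a b d + fieldTwo d a b c =
      sin (2 * y) * (cos (a + b - c - d) + cos (a + c - b - d) + cos (a + d - b - c) - 1) -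
        (sin (2 * a) + sin (2 * y - 2 * a) + (sin (2 * b) + sin (2 * y - 2 * b)) +
        (sin (2 * c) + sin (2 * y - 2 * c)) + (sin (2 * d) + sin (2 * y - 2 * d))) / 2 := by
    simp only [fieldTwo, hy, sin_two_mul, cos_two_mul, sin_add, cos_add, sin_sub, cos_sub]
    ring_nf
    simp only [sin_sq]
    ring
  rw [key]
  have hsum := sum_cos_add_cos a b c d y hy
  have hcos := cos_add_add_add a b c d
  rw [← hy] at hcos
  have hsplit : cos (a + b - c - d) + cos (a + c - b - d) + cos (a + d - b - c) =
      3 * (cos a * cos b * cos c * cos d) + sinPairs a b c d +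
        3 * (sin a * sin b * sin c * sin d) := by
    simp only [sinPairs, sin_add, cos_add, sin_sub, cos_sub]
    ring
  rw [hsplit]
  linear_combination (3 * (cos a * cos b * cos c * cos d) + sinPairs a b c d +
      3 * (sin a * sin b * sin c * sin d) - 1) * (sin_two_mul_mul_ccot h + hcos) -
    (sin_add_sin_mul_ccot h (2 * a) + sin_add_sin_mul_ccot h (2 * b) +
      sin_add_sin_mul_ccot h (2 * c) + sin_add_sin_mul_ccot h (2 * d)) / 2 - hsum

end Trigonometry

theorem halve_mem_F4pos {v : Fin 4 → ℤ} (hv : v ∈ doubledRoots) : halve v ∈ F4pos :=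
  F4pos_eq_image ▸ Finset.mem_image_of_mem _ hv

theorem F4mult_vec (q r a b c d : ℂ) :
    F4mult q r ![a, b, c, d] = if a * a + b * b + c * c + d * d = 2 then q else r := by
  simp only [F4mult, dotc, Fin.sum_univ_four]
  rfl

theorem dotc_vec (a b c d : ℂ) (x : Fin 4 → ℂ) :
    dotc ![a, b, c, d] x = a * x 0 + b * x 1 + c * x 2 + d * x 3 := by
  simp only [dotc, Fin.sum_univ_four]
  rfl

theorem sum_mul_F4mat (q r : ℂ) (x B : Fin 4 → ℂ) (p s : Fin 4) :
    ∑ k, B k * F4mat q r x k p s =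
      ∑ α ∈ F4pos, F4mult q r α * (α p * α s) * (dotc α B * ccot (dotc α x)) := by
  simp only [F4mat, Finset.mul_sum, dotc, Finset.sum_mul]
  rw [Finset.sum_comm]
  refine Finset.sum_congr rfl fun α _ => Finset.sum_congr rfl fun k _ => ?_
  ring

/-- The product of the coordinates `p` and `s` of the vector `(t₀, t₁, t₂, t₃)`. -/
def coordProd (p s : Fin 4) (t₀ t₁ t₂ t₃ : ℂ) : ℂ :=
  ![t₀, t₁, t₂, t₃] p * ![t₀, t₁, t₂, t₃] s

/-- If the vector field `B` has components given by a function `φ` that is odd in its first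
argument, and even and symmetric in the others, then the contraction of `B` with the tensor
`F4mat` is determined by the values of `(α, B) cot (α, x)` at `e₁`, `e₁ + e₂` and
`½(e₁ + e₂ + e₃ + e₄)`. -/
theorem contraction_eq (φ σ π η : ℂ → ℂ → ℂ → ℂ → ℂ)
    (hodd : ∀ a b c d, φ (-a) b c d = -φ a b c d)
    (heven : ∀ a b c d, φ a (-b) c d = φ a b c d)
    (hswap : ∀ a b c d, φ a b c d = φ a c b d)
    (hswap' : ∀ a b c d, φ a b c d = φ a b d c)
    (hσ : ∀ a b c d, Complex.sin a ≠ 0 → φ a b c d * ccot a = σ a b c d)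
    (hπ : ∀ a b c d, Complex.sin (a + b) ≠ 0 →
      (φ a b c d + φ b a c d) * ccot (a + b) = π a b c d)
    (hη : ∀ a b c d y, 2 * y = a + b + c + d → Complex.sin y ≠ 0 →
      (φ a b c d + φ b a c d + φ c a b d + φ d a b c) * ccot y = η a b c d)
    (q r a b c d : ℂ) (hsin : ∀ α ∈ F4pos, Complex.sin (dotc α ![a, b, c, d]) ≠ 0)
    (p s : Fin 4) :
    ∑ k, ![φ a b c d, φ b a c d, φ c a b d, φ d a b c] k * F4mat q r ![a, b, c, d] k p s =
      r * (coordProd p s 1 0 0 0 * σ a b c d + coordProd p s 0 1 0 0 * σ b a c d +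
        coordProd p s 0 0 1 0 * σ c a b d + coordProd p s 0 0 0 1 * σ d a b c) +
      q * (coordProd p s 1 1 0 0 * π a b c d + coordProd p s 1 (-1) 0 0 * π a (-b) c d +
        coordProd p s 1 0 1 0 * π a c b d + coordProd p s 1 0 (-1) 0 * π a (-c) b d +
        coordProd p s 1 0 0 1 * π a d b c + coordProd p s 1 0 0 (-1) * π a (-d) b c +
        coordProd p s 0 1 1 0 * π b c a d + coordProd p s 0 1 (-1) 0 * π b (-c) a d +
        coordProd p s 0 1 0 1 * π b d a c + coordProd p s 0 1 0 (-1) * π b (-d) a c +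
        coordProd p s 0 0 1 1 * π c d a b + coordProd p s 0 0 1 (-1) * π c (-d) a b) +
      r / 2 * (coordProd p s (1/2) (1/2) (1/2) (1/2) * η a b c d +
        coordProd p s (1/2) (1/2) (1/2) (-1/2) * η a b c (-d) +
        coordProd p s (1/2) (1/2) (-1/2) (1/2) * η a b (-c) d +
        coordProd p s (1/2) (1/2) (-1/2) (-1/2) * η a b (-c) (-d) +
        coordProd p s (1/2) (-1/2) (1/2) (1/2) * η a (-b) c d +
        coordProd p s (1/2) (-1/2) (1/2) (-1/2) * η a (-b) c (-d) +
        coordProd p s (1/2) (-1/2) (-1/2) (1/2) * η a (-b) (-c) d +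
        coordProd p s (1/2) (-1/2) (-1/2) (-1/2) * η a (-b) (-c) (-d)) := by
  have hsin' (v : Fin 4 → ℤ) (hv : v ∈ doubledRoots) {z : ℂ}
      (hz : z = (v 0 * a + v 1 * b + v 2 * c + v 3 * d) / 2) : Complex.sin z ≠ 0 := by
    have h := hsin _ (halve_mem_F4pos hv)
    have e : dotc (halve v) ![a, b, c, d] = z := by
      simp [dotc, halve, Fin.sum_univ_four, hz]
      ring
    rwa [e] at h
  have heven' (a b c d) : φ a b (-c) d = φ a b c d := by
    rw [hswap, heven, hswap]
  have heven'' (a b c d) : φ a b c (-d) = φ a b c d := by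
    rw [hswap', heven', hswap']
  have hrot (a b c d) : φ a d b c = φ a b c d := by
    rw [hswap, hswap']
  set x : Fin 4 → ℂ := ![a, b, c, d]
  set B : Fin 4 → ℂ := ![φ a b c d, φ b a c d, φ c a b d, φ d a b c]
  have dotx (t₀ t₁ t₂ t₃ : ℂ) : dotc ![t₀, t₁, t₂, t₃] x = t₀ * a + t₁ * b + t₂ * c + t₃ * d :=
    dotc_vec ..
  have dotB (t₀ t₁ t₂ t₃ : ℂ) : dotc ![t₀, t₁, t₂, t₃] B =
      t₀ * φ a b c d + t₁ * φ b a c d + t₂ * φ c a b d + t₃ * φ d a b c :=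
    dotc_vec ..
  have short (t₀ t₁ t₂ t₃ T : ℂ) (ht : t₀ * t₀ + t₁ * t₁ + t₂ * t₂ + t₃ * t₃ = 1)
      (hT : dotc ![t₀, t₁, t₂, t₃] B * ccot (dotc ![t₀, t₁, t₂, t₃] x) = T) :
      F4mult q r ![t₀, t₁, t₂, t₃] * (![t₀, t₁, t₂, t₃] p * ![t₀, t₁, t₂, t₃] s) *
        (dotc ![t₀, t₁, t₂, t₃] B * ccot (dotc ![t₀, t₁, t₂, t₃] x)) =
      r * coordProd p s t₀ t₁ t₂ t₃ * T := by
    rw [hT, F4mult_vec, ht, if_neg (by norm_num), coordProd]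
  have long (t₀ t₁ t₂ t₃ T : ℂ) (ht : t₀ * t₀ + t₁ * t₁ + t₂ * t₂ + t₃ * t₃ = 2)
      (hT : dotc ![t₀, t₁, t₂, t₃] B * ccot (dotc ![t₀, t₁, t₂, t₃] x) = T) :
      F4mult q r ![t₀, t₁, t₂, t₃] * (![t₀, t₁, t₂, t₃] p * ![t₀, t₁, t₂, t₃] s) *
        (dotc ![t₀, t₁, t₂, t₃] B * ccot (dotc ![t₀, t₁, t₂, t₃] x)) =
      q * coordProd p s t₀ t₁ t₂ t₃ * T := by
    rw [hT, F4mult_vec, ht, if_pos rfl, coordProd]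
  have half (n₁ n₂ n₃ : ℤ) (h₁ : n₁ = 1 ∨ n₁ = -1) (h₂ : n₂ = 1 ∨ n₂ = -1)
      (h₃ : n₃ = 1 ∨ n₃ = -1) :
      dotc ![1/2, n₁/2, n₂/2, n₃/2] B * ccot (dotc ![1/2, n₁/2, n₂/2, n₃/2] x) =
        η a (n₁ * b) (n₂ * c) (n₃ * d) / 2 := by
    have hy : 2 * dotc ![1/2, n₁/2, n₂/2, n₃/2] x = a + n₁ * b + n₂ * c + n₃ * d := by
      rw [dotx]
      ring
    have hmem : ![1, n₁, n₂, n₃] ∈ doubledRoots := by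
      rcases h₁ with rfl | rfl <;> rcases h₂ with rfl | rfl <;> rcases h₃ with rfl | rfl <;> decide
    rw [← hη _ _ _ _ _ hy (hsin' _ hmem (by simp [dotx]; ring)), dotB]
    rcases h₁ with rfl | rfl <;> rcases h₂ with rfl | rfl <;> rcases h₃ with rfl | rfl <;>
      simp [hodd, heven, heven', heven''] <;> ring
  rw [sum_mul_F4mat, sum_F4pos,
    short 1 0 0 0 (σ a b c d) (by norm_num)
      (by simpa [dotx, dotB] using hσ a b c d (hsin' ![2, 0, 0, 0] (by decide) (by simp))),
    short 0 1 0 0 (σ b a c d) (by norm_num)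
      (by simpa [dotx, dotB] using hσ b a c d (hsin' ![0, 2, 0, 0] (by decide) (by simp))),
    short 0 0 1 0 (σ c a b d) (by norm_num)
      (by simpa [dotx, dotB] using hσ c a b d (hsin' ![0, 0, 2, 0] (by decide) (by simp))),
    short 0 0 0 1 (σ d a b c) (by norm_num)
      (by simpa [dotx, dotB] using hσ d a b c (hsin' ![0, 0, 0, 2] (by decide) (by simp))),
    long 1 1 0 0 (π a b c d) (by norm_num)
      (by simpa [dotx, dotB]
        using hπ a b c d (hsin' ![2, 2, 0, 0] (by decide) (by simp; ring))),
    long 1 (-1) 0 0 (π a (-b) c d) (by norm_num)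
      (by simpa [dotx, dotB, hodd, heven]
        using hπ a (-b) c d (hsin' ![2, -2, 0, 0] (by decide) (by simp; ring))),
    long 1 0 1 0 (π a c b d) (by norm_num)
      (by simpa [dotx, dotB, hswap a c b d]
        using hπ a c b d (hsin' ![2, 0, 2, 0] (by decide) (by simp; ring))),
    long 1 0 (-1) 0 (π a (-c) b d) (by norm_num)
      (by simpa [dotx, dotB, hodd, heven, hswap a c b d]
        using hπ a (-c) b d (hsin' ![2, 0, -2, 0] (by decide) (by simp; ring))),
    long 1 0 0 1 (π a d b c) (by norm_num)
      (by simpa [dotx, dotB, hrot a b c d]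
        using hπ a d b c (hsin' ![2, 0, 0, 2] (by decide) (by simp; ring))),
    long 1 0 0 (-1) (π a (-d) b c) (by norm_num)
      (by simpa [dotx, dotB, hodd, heven, hrot a b c d]
        using hπ a (-d) b c (hsin' ![2, 0, 0, -2] (by decide) (by simp; ring))),
    long 0 1 1 0 (π b c a d) (by norm_num)
      (by simpa [dotx, dotB, hswap b c a d, hswap c b a d]
        using hπ b c a d (hsin' ![0, 2, 2, 0] (by decide) (by simp; ring))),
    long 0 1 (-1) 0 (π b (-c) a d) (by norm_num)
      (by simpa [dotx, dotB, hodd, heven, hswap b c a d, hswap c b a d]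
        using hπ b (-c) a d (hsin' ![0, 2, -2, 0] (by decide) (by simp; ring))),
    long 0 1 0 1 (π b d a c) (by norm_num)
      (by simpa [dotx, dotB, hrot b a c d, hswap d b a c]
        using hπ b d a c (hsin' ![0, 2, 0, 2] (by decide) (by simp; ring))),
    long 0 1 0 (-1) (π b (-d) a c) (by norm_num)
      (by simpa [dotx, dotB, hodd, heven, hrot b a c d, hswap d b a c]
        using hπ b (-d) a c (hsin' ![0, 2, 0, -2] (by decide) (by simp; ring))),
    long 0 0 1 1 (π c d a b) (by norm_num)
      (by simpa [dotx, dotB, hrot c a b d, hrot d a b c]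
        using hπ c d a b (hsin' ![0, 0, 2, 2] (by decide) (by simp; ring))),
    long 0 0 1 (-1) (π c (-d) a b) (by norm_num)
      (by simpa [dotx, dotB, hodd, heven, hrot c a b d, hrot d a b c]
        using hπ c (-d) a b (hsin' ![0, 0, 2, -2] (by decide) (by simp; ring))),
    short (1/2) (1/2) (1/2) (1/2) (η a b c d / 2) (by norm_num)
      (by simpa using half 1 1 1 (by simp) (by simp) (by simp)),
    short (1/2) (1/2) (1/2) (-1/2) (η a b c (-d) / 2) (by norm_num)
      (by simpa using half 1 1 (-1) (by simp) (by simp) (by simp)),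
    short (1/2) (1/2) (-1/2) (1/2) (η a b (-c) d / 2) (by norm_num)
      (by simpa using half 1 (-1) 1 (by simp) (by simp) (by simp)),
    short (1/2) (1/2) (-1/2) (-1/2) (η a b (-c) (-d) / 2) (by norm_num)
      (by simpa using half 1 (-1) (-1) (by simp) (by simp) (by simp)),
    short (1/2) (-1/2) (1/2) (1/2) (η a (-b) c d / 2) (by norm_num)
      (by simpa using half (-1) 1 1 (by simp) (by simp) (by simp)),
    short (1/2) (-1/2) (1/2) (-1/2) (η a (-b) c (-d) / 2) (by norm_num)
      (by simpa using half (-1) 1 (-1) (by simp) (by simp) (by simp)),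
    short (1/2) (-1/2) (-1/2) (1/2) (η a (-b) (-c) d / 2) (by norm_num)
      (by simpa using half (-1) (-1) 1 (by simp) (by simp) (by simp)),
    short (1/2) (-1/2) (-1/2) (-1/2) (η a (-b) (-c) (-d) / 2) (by norm_num)
      (by simpa using half (-1) (-1) (-1) (by simp) (by simp) (by simp))]
  ring

section Cases

open Complex

theorem six_mul_add_sum_F4pos (q a b c d : ℂ) :
    6 * q + (1 / 2) * ∑ α ∈ F4pos, F4mult q (-2 * q) α * cos (2 * dotc α ![a, b, c, d]) =
      q * (6 + cos (2 * a) * (cos (2 * b) + cos (2 * c) + cos (2 * d)) +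
        cos (2 * b) * (cos (2 * c) + cos (2 * d)) + cos (2 * c) * cos (2 * d) -
        (cos (2 * a) + cos (2 * b) + cos (2 * c) + cos (2 * d)) -
        8 * (cos a * cos b * cos c * cos d)) := by
  have double (t : ℂ) : 2 * (1 / 2 * t) = t := by ring
  have double' (t : ℂ) : 2 * (-1 / 2 * t) = -t := by ring
  rw [sum_F4pos]
  simp only [F4mult_vec, dotc_vec, Matrix.cons_val, mul_add, double, double', zero_mul, mul_zero,
    add_zero, zero_add, one_mul, neg_mul, mul_neg, cos_add, sin_add, cos_neg, sin_neg]
  norm_num only [if_true, if_false]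
  ring

set_option maxHeartbeats 1000000 in
theorem contraction_two (q a b c d : ℂ)
    (hsin : ∀ α ∈ F4pos, sin (dotc α ![a, b, c, d]) ≠ 0) (p s : Fin 4) :
    ∑ k, ![fieldTwo a b c d, fieldTwo b a c d, fieldTwo c a b d, fieldTwo d a b c] k *
        F4mat q (-2 * q) ![a, b, c, d] k p s =
      if p = s then 6 * q + (1 / 2) * ∑ α ∈ F4pos, F4mult q (-2 * q) α *
        cos (2 * dotc α ![a, b, c, d]) else 0 := by
  rw [six_mul_add_sum_F4pos, contraction_eq fieldTwo
    (fun a b c d => cos a * (cos a * (-1 + cos (2 * b) + cos (2 * c) + cos (2 * d))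
      - 2 * (cos b * cos c * cos d)))
    _ _
    (fun a b c d => by simp [fieldTwo])
    (fun a b c d => by simp [fieldTwo])
    (fun a b c d => by simp only [fieldTwo]; ring)
    (fun a b c d => by simp only [fieldTwo]; ring)
    (fun a b c d h => by rw [fieldTwo, mul_right_comm, sin_mul_ccot h])
    fieldTwo_add_mul_ccot
    fieldTwo_sum_mul_ccot
    q _ a b c d hsin]
  simp only [sinPairs, cos_add, cos_sub, sin_neg, cos_neg, cos_two_mul]
  fin_cases p <;> fin_cases s <;>
    simp only [coordProd, Fin.zero_eta, Fin.mk_one, Fin.reduceFinMk, Matrix.cons_val, Fin.reduceEq,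
      if_true, if_false, mul_zero, zero_mul, add_zero, zero_add] <;>
    ring_nf <;> simp only [sin_sq] <;> ring

theorem contraction_four (q a b c d : ℂ)
    (hsin : ∀ α ∈ F4pos, sin (dotc α ![a, b, c, d]) ≠ 0) (p s : Fin 4) :
    ∑ k, ![fieldFour a b c d, fieldFour b a c d, fieldFour c a b d, fieldFour d a b c] k *
        F4mat q (-4 * q) ![a, b, c, d] k p s =
      if p = s then -q * (6 + (cos (2 * a) + cos (2 * b) + cos (2 * c) + cos (2 * d)) +
        8 * (cos a * cos b * cos c * cos d)) else 0 := by
  rw [contraction_eq fieldFour (fun a b c d => cos a * (cos a + 2 * (cos b * cos c * cos d))) _ _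
    (fun a b c d => by simp [fieldFour])
    (fun a b c d => by simp [fieldFour])
    (fun a b c d => by simp only [fieldFour]; ring)
    (fun a b c d => by simp only [fieldFour]; ring)
    (fun a b c d h => by rw [fieldFour, mul_right_comm, sin_mul_ccot h])
    fieldFour_add_mul_ccot
    fieldFour_sum_mul_ccot
    q _ a b c d hsin]
  simp only [sinPairs, cos_add, cos_sub, sin_neg, cos_neg, cos_two_mul]
  fin_cases p <;> fin_cases s <;>
    simp only [coordProd, Fin.zero_eta, Fin.mk_one, Fin.reduceFinMk, Matrix.cons_val, Fin.reduceEq,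
      if_true, if_false, mul_zero, zero_mul, add_zero, zero_add] <;>
    ring_nf <;> simp only [sin_sq] <;> ring

end Cases

/-- explicit identity field for the `F₄` solutions: the matrix
`h⁻¹ Σ_k B^k F_k` is the identity in the two cases `r = −2q` and `r = −4q`. -/
theorem stmt19 (q r : ℂ) (hq : q ≠ 0) (x : Fin 4 → ℂ)
    (hsin : ∀ α ∈ F4pos, Complex.sin (dotc α x) ≠ 0) :
    ((r = -2 * q →
      ∀ B : Fin 4 → ℂ,
        (∀ k, B k = Complex.sin (x k) *
          (Complex.cos (x k) * (-1 + ∑ i ∈ Finset.univ.erase k, Complex.cos (2 * x i))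
            - 2 * ∏ i ∈ Finset.univ.erase k, Complex.cos (x i))) →
      ∀ h : ℂ,
        h = 6 * q + (1 / 2) * ∑ α ∈ F4pos, F4mult q r α * Complex.cos (2 * dotc α x) →
        h ≠ 0 →
      ∀ p s : Fin 4,
        h⁻¹ * ∑ k, B k * F4mat q r x k p s = if p = s then 1 else 0)
    ∧
    (r = -4 * q →
      ∀ B : Fin 4 → ℂ,
        (∀ k, B k = Complex.sin (x k) *
          (Complex.cos (x k) + 2 * ∏ i ∈ Finset.univ.erase k, Complex.cos (x i))) →
      ∀ h : ℂ,
        h = -q * (6 + (∑ i, Complex.cos (2 * x i)) + 8 * ∏ i, Complex.cos (x i)) →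
        h ≠ 0 →
      ∀ p s : Fin 4,
        h⁻¹ * ∑ k, B k * F4mat q r x k p s = if p = s then 1 else 0)) := by
  obtain ⟨a, b, c, d, rfl⟩ : ∃ a b c d, x = ![a, b, c, d] :=
    ⟨x 0, x 1, x 2, x 3, by funext k; fin_cases k <;> rfl⟩
  have erase₀ : (Finset.univ.erase 0 : Finset (Fin 4)) = {1, 2, 3} := by decide
  have erase₁ : (Finset.univ.erase 1 : Finset (Fin 4)) = {0, 2, 3} := by decide
  have erase₂ : (Finset.univ.erase 2 : Finset (Fin 4)) = {0, 1, 3} := by decide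
  have erase₃ : (Finset.univ.erase 3 : Finset (Fin 4)) = {0, 1, 2} := by decide
  constructor
  · rintro rfl B hB h rfl hh p s
    obtain rfl : B = ![fieldTwo a b c d, fieldTwo b a c d, fieldTwo c a b d, fieldTwo d a b c] := by
      funext k
      rw [hB]
      fin_cases k <;> simp [fieldTwo, erase₀, erase₁, erase₂, erase₃] <;> ring_nf <;> simp
    rw [contraction_two q a b c d hsin, mul_ite, mul_zero, inv_mul_cancel₀ hh]
  · rintro rfl B hB h hdef hh p s
    obtain rfl :
        B = ![fieldFour a b c d, fieldFour b a c d, fieldFour c a b d, fieldFour d a b c] := by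
      funext k
      rw [hB]
      fin_cases k <;> simp [fieldFour, erase₀, erase₁, erase₂, erase₃] <;> ring_nf <;> simp
    simp only [Fin.sum_univ_four, Fin.prod_univ_four, Matrix.cons_val] at hdef
    rw [contraction_four q a b c d hsin, ← hdef, mul_ite, mul_zero, inv_mul_cancel₀ hh]
end
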